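/- Let G be a simple graph and H the clique substitution of G. Then H is claw-free, i.e., H contains no induced subgraph isomorphic to K_{1,3}. -/

import Mathlib

/-- The claw `K_{1,3}`: the star on four vertices with center `0`. -/
def claw : SimpleGraph (Fin 4) := SimpleGraph.fromRel (fun i _ => i = 0)

/-- The clique substitution of a simple graph `G`: the vertex set is
`{(v,u) : v ∈ V(G), u ∈ N_G(v)}`; two distinct vertices are adjacent iff they
have the same first coordinate (the cliques `K^v`), or they are `(u,v)` and
`(v,u)` for an edge `uv` of `G`. -/
def cliqueSub {V : Type*} (G : SimpleGraph V) :
    SimpleGraph {p : V × V // G.Adj p.1 p.2} :=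
  SimpleGraph.fromRel (fun a b => a.1.1 = b.1.1 ∨ (a.1.1 = b.1.2 ∧ a.1.2 = b.1.1))

/-- A graph is `H`-free if it contains no induced subgraph isomorphic to `H`,
i.e. there is no graph embedding of `H` into it. -/
def InducedFree {W V : Type*} (H : SimpleGraph W) (G : SimpleGraph V) : Prop :=
  IsEmpty (H ↪g G)

theorem cliqueSub_adj {V : Type*} {G : SimpleGraph V} {a b : {p : V × V // G.Adj p.1 p.2}} :
    (cliqueSub G).Adj a b ↔ a ≠ b ∧ (a.1.1 = b.1.1 ∨ b.1 = a.1.swap) := by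
  simp only [cliqueSub, SimpleGraph.fromRel_adj, Prod.ext_iff, Prod.fst_swap, Prod.snd_swap]
  grind

/-- Among three distinct neighbors of a vertex of a clique substitution, two are adjacent. -/
theorem cliqueSub_neighbors {V : Type*} {G : SimpleGraph V}
    {c x y z : {p : V × V // G.Adj p.1 p.2}} (hx : (cliqueSub G).Adj c x)
    (hy : (cliqueSub G).Adj c y) (hz : (cliqueSub G).Adj c z)
    (hxy : x ≠ y) (hxz : x ≠ z) (hyz : y ≠ z) :
    (cliqueSub G).Adj x y ∨ (cliqueSub G).Adj x z ∨ (cliqueSub G).Adj y z := by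
  simp only [cliqueSub_adj] at *
  grind

theorem stmt_8 {V : Type*} (G : SimpleGraph V) :
    InducedFree claw (cliqueSub G) := by
  refine ⟨fun f => ?_⟩
  have hc (i : Fin 4) (hi : i ≠ 0) : (cliqueSub G).Adj (f 0) (f i) :=
    f.map_adj_iff.2 (by simp [claw, hi.symm])
  have hl (i j : Fin 4) (hi : i ≠ 0) (hj : j ≠ 0) : ¬ (cliqueSub G).Adj (f i) (f j) :=
    fun h => by simpa [claw, hi, hj] using f.map_adj_iff.1 h
  rcases cliqueSub_neighbors (hc 1 (by decide)) (hc 2 (by decide)) (hc 3 (by decide))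
      (f.injective.ne (by decide)) (f.injective.ne (by decide))
      (f.injective.ne (by decide)) with h | h | h
  · exact hl 1 2 (by decide) (by decide) h
  · exact hl 1 3 (by decide) (by decide) h
  · exact hl 2 3 (by decide) (by decide) h
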